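/- Let Ω ⊂ ℝ^d (d ≥ 1) be a bounded domain, p ∈ (0,1), a, b ∈ L²(Ω) with a < b a.e., and ū ∈ U_ad. Then the limiting subdifferential ∂(j + I_{U_ad})(ū) coincides with the Fréchet subdifferential ∂̂(j + I_{U_ad})(ū), and both equal the set of all η ∈ L²(Ω) with: η(x) ≥ p·|ū(x)|^{p−2}·ū(x) for a.e. x ∈ {ū = b} ∩ {ū ≠ 0}, η(x) ≤ p·|ū(x)|^{p−2}·ū(x) for a.e. x ∈ {ū = a} ∩ {ū ≠ 0}, and η(x) = p·|ū(x)|^{p−2}·ū(x) for a.e. x ∈ {a < ū < b} ∩ {ū ≠ 0} (here |ū|^{p−2}ū means sign(ū)·|ū|^{p−1}). -/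

import Mathlib

open MeasureTheory Filter Topology RealInnerProductSpace
open scoped Classical

/-- `η` belongs to the Fréchet subdifferential `∂̂g(u)` of `g : U → ℝ ∪ {+∞} ⊆ EReal`:
`liminf_{‖h‖ → 0} (g(u + h) − g(u) − ⟨η, h⟩)/‖h‖ ≥ 0`. -/
def InFrechetSubdiff {U : Type*} [NormedAddCommGroup U] [InnerProductSpace ℝ U]
    (g : U → EReal) (u η : U) : Prop :=
  0 ≤ Filter.liminf
      (fun h : U => (g (u + h) - g u - (((⟪η, h⟫ : ℝ)) : EReal)) * ((‖h‖⁻¹ : ℝ) : EReal))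
      (nhdsWithin 0 {(0 : U)}ᶜ)

/-- `η` belongs to the limiting subdifferential `∂g(u)`: there are sequences `u_k → u`
strongly with `g(u_k) → g(u)` and `η_k ⇀ η` weakly with `η_k ∈ ∂̂g(u_k)` for all `k`. -/
def InLimitingSubdiff {U : Type*} [NormedAddCommGroup U] [InnerProductSpace ℝ U]
    (g : U → EReal) (u η : U) : Prop :=
  ∃ uk ηk : ℕ → U,
    Tendsto uk atTop (nhds u) ∧
    Tendsto (fun k => g (uk k)) atTop (nhds (g u)) ∧
    (∀ v : U, Tendsto (fun k => (⟪ηk k, v⟫ : ℝ)) atTop (nhds (⟪η, v⟫ : ℝ))) ∧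
    ∀ k, InFrechetSubdiff g (uk k) (ηk k)

/-- The derivative `p · sign(u) · |u|^(p-1)` of `u ↦ |u|^p` at `u ≠ 0`. -/
noncomputable def absRpowDeriv (p u : ℝ) : ℝ := p * (Real.sign u * |u| ^ (p - 1))

lemma absRpowDeriv_of_pos {p u : ℝ} (hu : 0 < u) : absRpowDeriv p u = p * |u| ^ (p - 1) := by
  simp [absRpowDeriv, Real.sign_of_pos hu]

lemma absRpowDeriv_of_neg {p u : ℝ} (hu : u < 0) : absRpowDeriv p u = -(p * |u| ^ (p - 1)) := by
  simp [absRpowDeriv, Real.sign_of_neg hu]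

lemma abs_absRpowDeriv {p u : ℝ} (hp : 0 ≤ p) (hu : u ≠ 0) :
    |absRpowDeriv p u| = p * |u| ^ (p - 1) := by
  have h : 0 ≤ p * |u| ^ (p - 1) := by positivity
  rcases lt_or_gt_of_ne hu with hu | hu
  · rw [absRpowDeriv_of_neg hu, abs_neg, abs_of_nonneg h]
  · rw [absRpowDeriv_of_pos hu, abs_of_nonneg h]

lemma hasDerivAt_abs_rpow_const (p : ℝ) {u : ℝ} (hu : u ≠ 0) :
    HasDerivAt (fun x : ℝ => |x| ^ p) (absRpowDeriv p u) u := by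
  have h : HasDerivAt (fun x : ℝ => |x| ^ p) (p * |u| ^ (p - 1) * (SignType.sign u : ℝ)) u :=
    (Real.hasDerivAt_rpow_const (p := p) (Or.inl (abs_ne_zero.2 hu))).comp u (hasDerivAt_abs hu)
  rcases lt_or_gt_of_ne hu with hu | hu
  · rw [absRpowDeriv_of_neg hu]; simpa [hu] using h
  · rw [absRpowDeriv_of_pos hu]; simpa [hu] using h

lemma continuousAt_absRpowDeriv (p : ℝ) {u : ℝ} (hu : u ≠ 0) :
    ContinuousAt (absRpowDeriv p) u := by
  have h : ContinuousAt (fun x : ℝ => |x| ^ (p - 1)) u :=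
    continuous_abs.continuousAt.rpow_const (Or.inl (abs_ne_zero.2 hu))
  rcases lt_or_gt_of_ne hu with hu | hu
  · refine (h.const_mul p).neg.congr ?_
    filter_upwards [Iio_mem_nhds hu] with x hx using (absRpowDeriv_of_neg hx).symm
  · refine (h.const_mul p).congr ?_
    filter_upwards [Ioi_mem_nhds hu] with x hx using (absRpowDeriv_of_pos hx).symm

lemma measurable_absRpowDeriv (p : ℝ) : Measurable (absRpowDeriv p) := by
  have h : Measurable Real.sign := by
    unfold Real.sign
    exact Measurable.ite measurableSet_Iio measurable_const
      (Measurable.ite measurableSet_Ioi measurable_const measurable_const)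
  unfold absRpowDeriv
  fun_prop

lemma abs_rpow_sub_abs_rpow_le {p : ℝ} (hp0 : 0 < p) (hp1 : p < 1) {u : ℝ} (hu : u ≠ 0) (t : ℝ) :
    |u + t| ^ p - |u| ^ p ≤ |u| ^ (p - 1) * |t| := by
  have hpos : 0 < |u| := abs_pos.2 hu
  have h1 : |u + t| ^ p ≤ (|u| * (1 + |t| / |u|)) ^ p := by
    refine Real.rpow_le_rpow (abs_nonneg _) ?_ hp0.le
    rw [mul_add, mul_one, mul_div_cancel₀ _ hpos.ne']
    exact abs_add_le _ _
  have hge : 1 ≤ 1 + |t| / |u| := by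
    have : 0 ≤ |t| / |u| := by positivity
    linarith
  have h2 : (1 + |t| / |u|) ^ p ≤ 1 + |t| / |u| := by
    simpa using Real.rpow_le_rpow_of_exponent_le hge hp1.le
  rw [Real.mul_rpow hpos.le (by linarith)] at h1
  have h3 := mul_le_mul_of_nonneg_left h2 (Real.rpow_nonneg hpos.le p)
  have h4 : |u| ^ p * (1 + |t| / |u|) = |u| ^ p + |u| ^ (p - 1) * |t| := by
    rw [Real.rpow_sub_one hpos.ne']; field_simp
  linarith

lemma abs_rpow_sub_le_abs_rpow {p : ℝ} (hp0 : 0 < p) (hp1 : p < 1) {u : ℝ} (hu : u ≠ 0) (t : ℝ) :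
    |u| ^ p - |u + t| ^ p ≤ |u| ^ (p - 1) * |t| := by
  have hpos : 0 < |u| := abs_pos.2 hu
  have h4 : |u| ^ p * (|t| / |u|) = |u| ^ (p - 1) * |t| := by
    rw [Real.rpow_sub_one hpos.ne']; field_simp
  rcases le_total |u| |t| with h | h
  · have h1 : 1 ≤ |t| / |u| := (one_le_div hpos).2 h
    have h2 := mul_le_mul_of_nonneg_left h1 (Real.rpow_nonneg hpos.le p)
    have h3 : 0 ≤ |u + t| ^ p := by positivity
    linarith
  · have hle : |t| / |u| ≤ 1 := (div_le_one hpos).2 h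
    have hge : 0 ≤ |t| / |u| := by positivity
    have h1 : (|u| * (1 - |t| / |u|)) ^ p ≤ |u + t| ^ p := by
      refine Real.rpow_le_rpow (mul_nonneg hpos.le (by linarith)) ?_ hp0.le
      rw [mul_sub, mul_one, mul_div_cancel₀ _ hpos.ne']
      have := abs_sub_abs_le_abs_sub u (-t)
      rwa [abs_neg, sub_neg_eq_add] at this
    have h2 : 1 - |t| / |u| ≤ (1 - |t| / |u|) ^ p := by
      rcases hle.eq_or_lt with h | h
      · simp [h, Real.zero_rpow hp0.ne']
      · simpa using Real.rpow_le_rpow_of_exponent_ge (sub_pos.2 h) (sub_le_self 1 hge) hp1.le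
    rw [Real.mul_rpow hpos.le (by linarith)] at h1
    have h3 := mul_le_mul_of_nonneg_left h2 (Real.rpow_nonneg hpos.le p)
    linarith

lemma abs_abs_rpow_sub_le {p : ℝ} (hp0 : 0 < p) (hp1 : p < 1) {u : ℝ} (hu : u ≠ 0) (t : ℝ) :
    |(|u + t| ^ p - |u| ^ p)| ≤ |u| ^ (p - 1) * |t| :=
  abs_le.2 ⟨by linarith [abs_rpow_sub_le_abs_rpow hp0 hp1 hu t],
    abs_rpow_sub_abs_rpow_le hp0 hp1 hu t⟩

/-- Along directions `t` on which the slope `η` does not exceed the derivative, the defect of the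
linearisation of `|·|^p` is bounded by a multiple of `|η| |t|`. -/
lemma abs_rpow_defect_le {p : ℝ} (hp0 : 0 < p) (hp1 : p < 1) {u t η : ℝ}
    (h : u ≠ 0 → 0 ≤ (absRpowDeriv p u - η) * t) :
    |u| ^ p + η * t - |u + t| ^ p ≤ (1 + 1 / p) * |η| * |t| := by
  have hle : η * t ≤ |η| * |t| := by rw [← abs_mul]; exact le_abs_self _
  have hnn : 0 ≤ 1 / p * (|η| * |t|) := by positivity
  suffices |u| ^ p - |u + t| ^ p ≤ 1 / p * (|η| * |t|) by linarith
  rcases eq_or_ne u 0 with rfl | hu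
  · have : 0 ≤ |0 + t| ^ p := by positivity
    rw [abs_zero, Real.zero_rpow hp0.ne']
    linarith
  specialize h hu
  rcases le_or_gt 0 (u * t) with hut | hut
  · have : |u| ^ p ≤ |u + t| ^ p := by
      refine Real.rpow_le_rpow (abs_nonneg _) (sq_le_sq.1 ?_) hp0.le
      nlinarith [sq_nonneg t]
    linarith
  · have hη : p * |u| ^ (p - 1) ≤ |η| := by
      rcases lt_or_gt_of_ne hu with hu | hu
      · have ht : 0 < t := by nlinarith
        rw [absRpowDeriv_of_neg hu] at h
        have := nonneg_of_mul_nonneg_left h ht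
        linarith [neg_le_abs η]
      · have ht : t < 0 := by nlinarith
        rw [absRpowDeriv_of_pos hu] at h
        have := nonpos_of_mul_nonneg_left h ht
        linarith [le_abs_self η]
    have hη' : |u| ^ (p - 1) ≤ 1 / p * |η| := by
      rw [one_div, ← div_eq_inv_mul, le_div_iff₀ hp0]; linarith
    have := mul_le_mul_of_nonneg_right hη' (abs_nonneg t)
    linarith [abs_rpow_sub_le_abs_rpow hp0 hp1 hu t]

lemma eventually_abs_rpow_defect_le {p : ℝ} (hp0 : 0 < p) (hp1 : p < 1) (u η : ℝ) {ε : ℝ}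
    (hε : 0 < ε) :
    ∀ᶠ t in 𝓝 (0 : ℝ), (u ≠ 0 → 0 ≤ (absRpowDeriv p u - η) * t) →
      |u| ^ p + η * t - |u + t| ^ p ≤ ε * |t| := by
  rcases eq_or_ne u 0 with rfl | hu
  · have h : Tendsto (fun t : ℝ => |η| * |t| ^ (1 - p)) (𝓝 0) (𝓝 0) := by
      have : Continuous fun t : ℝ => |η| * |t| ^ (1 - p) :=
        continuous_const.mul (continuous_abs.rpow_const fun _ => Or.inr (by linarith))
      simpa [Real.zero_rpow (by linarith : 1 - p ≠ 0)] using this.tendsto 0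
    filter_upwards [h.eventually_lt_const one_pos] with t ht _
    rw [abs_zero, Real.zero_rpow hp0.ne', zero_add, zero_add]
    have h1 : |t| ^ p * |t| ^ (1 - p) = |t| := by
      rw [← Real.rpow_add' (abs_nonneg _) (by simp)]; simp
    have h2 := mul_le_mul_of_nonneg_left ht.le (Real.rpow_nonneg (abs_nonneg t) p)
    have hle : η * t ≤ |η| * |t| := by rw [← abs_mul]; exact le_abs_self _
    have h3 : 0 ≤ ε * |t| := by positivity
    have h4 : |t| ^ p * (|η| * |t| ^ (1 - p)) = |η| * |t| := by
      rw [mul_left_comm, h1]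
    linarith
  · have h := (hasDerivAt_iff_isLittleO_nhds_zero.1 (hasDerivAt_abs_rpow_const p hu)).def hε
    filter_upwards [h] with t ht hη
    specialize hη hu
    rw [smul_eq_mul, Real.norm_eq_abs, Real.norm_eq_abs] at ht
    have := (abs_le.1 ht).1
    linarith

/-- Real-valued `ε`-form of the Fréchet subdifferential of a finite function plus an indicator. -/
lemma inFrechetSubdiff_add_indicator_iff {U : Type*} [NormedAddCommGroup U] [InnerProductSpace ℝ U]
    {j : U → ℝ} {S : U → Prop} {u η : U} (hu : S u) :
    InFrechetSubdiff (fun v : U => ((j v : ℝ) : EReal) + (if S v then (0 : EReal) else ⊤)) u η ↔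
      ∀ ε > 0, ∀ᶠ h in 𝓝 (0 : U), S (u + h) → -(ε * ‖h‖) ≤ j (u + h) - j u - ⟪η, h⟫ := by
  unfold InFrechetSubdiff
  rw [Filter.le_liminf_iff]
  constructor
  · intro H ε hε
    have hlt : ((-ε : ℝ) : EReal) < 0 := by exact_mod_cast neg_lt_zero.2 hε
    have := eventually_nhdsWithin_iff.1 (H _ hlt)
    filter_upwards [this] with h hh hS
    rcases eq_or_ne h 0 with rfl | h0
    · simp
    have hh := hh h0
    simp only [hu, hS, if_true, add_zero] at hh
    have hh : -ε < (j (u + h) - j u - ⟪η, h⟫) * ‖h‖⁻¹ := by exact_mod_cast hh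
    rw [← div_eq_mul_inv, lt_div_iff₀ (norm_pos_iff.2 h0)] at hh
    linarith
  · intro H y hy
    obtain ⟨c, hyc, hc⟩ := EReal.lt_iff_exists_real_btwn.1 hy
    have hc : c < 0 := by exact_mod_cast hc
    refine eventually_nhdsWithin_iff.2 ?_
    filter_upwards [H (-c) (by linarith)] with h hh h0
    have hpos : 0 < ‖h‖ := norm_pos_iff.2 h0
    by_cases hS : S (u + h)
    · have hh := hh hS
      simp only [hu, hS, if_true, add_zero]
      refine lt_of_lt_of_le hyc ?_
      have : c ≤ (j (u + h) - j u - ⟪η, h⟫) * ‖h‖⁻¹ := by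
        rw [← div_eq_mul_inv, le_div_iff₀ hpos]; linarith
      exact_mod_cast this
    · simp only [hu, hS, if_true, if_false, add_zero]
      rw [EReal.coe_add_top, EReal.top_sub_coe, EReal.top_sub_coe,
        EReal.top_mul_of_pos (by exact_mod_cast inv_pos.2 hpos)]
      exact hyc.trans (EReal.coe_lt_top c)

section Measure

variable {α : Type*} {m : MeasurableSpace α} {μ : Measure α}

lemma Lp_measurable (f : Lp ℝ 2 μ) : Measurable (f : α → ℝ) := (Lp.stronglyMeasurable f).measurable

lemma Lp_integrable_sq (f : Lp ℝ 2 μ) : Integrable (fun x => f x ^ 2) μ :=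
  (Lp.memLp f).integrable_sq

lemma Lp_integrable_mul (f g : Lp ℝ 2 μ) : Integrable (fun x => f x * g x) μ :=
  (Lp.memLp f).integrable_mul (Lp.memLp g)

lemma Lp_inner_eq_integral (f g : Lp ℝ 2 μ) : (⟪f, g⟫ : ℝ) = ∫ x, f x * g x ∂μ := by
  simp [L2.inner_def, mul_comm]

lemma Lp_norm_sq_eq_integral (f : Lp ℝ 2 μ) : ‖f‖ ^ 2 = ∫ x, f x ^ 2 ∂μ := by
  rw [← real_inner_self_eq_norm_sq, Lp_inner_eq_integral]
  simp only [sq]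

lemma Lp_integrable [IsFiniteMeasure μ] (f : Lp ℝ 2 μ) : Integrable f μ :=
  (Lp.memLp f).integrable (by norm_num)

lemma integrable_abs_rpow [IsFiniteMeasure μ] {p : ℝ} (hp0 : 0 < p) (hp1 : p < 1) (f : Lp ℝ 2 μ) :
    Integrable (fun x => |f x| ^ p) μ := by
  have hf := Lp_measurable f
  refine ((integrable_const (1 : ℝ)).add (Lp_integrable f).abs).mono'
    (by fun_prop : Measurable _).aestronglyMeasurable (ae_of_all _ fun x => ?_)
  have h0 : 0 ≤ |f x| := abs_nonneg _
  rw [Real.norm_eq_abs, abs_of_nonneg (Real.rpow_nonneg h0 p)]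
  simp only [Pi.add_apply]
  rcases le_total |f x| 1 with h | h
  · linarith [Real.rpow_le_one h0 h hp0.le]
  · have := Real.rpow_le_rpow_of_exponent_le h hp1.le
    rw [Real.rpow_one] at this
    linarith

/-- The pointwise variational inequality implies the Fréchet inequality. -/
lemma eventually_neg_mul_norm_le [IsFiniteMeasure μ] {p : ℝ} (hp0 : 0 < p) (hp1 : p < 1)
    {a b : α → ℝ} {u η : Lp ℝ 2 μ}
    (H : ∀ᵐ x ∂μ, u x ≠ 0 → ∀ v, a x ≤ v → v ≤ b x →
      0 ≤ (absRpowDeriv p (u x) - η x) * (v - u x)) {ε : ℝ} (hε : 0 < ε) :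
    ∀ᶠ h in 𝓝 (0 : Lp ℝ 2 μ), (∀ᵐ x ∂μ, a x ≤ (u + h) x ∧ (u + h) x ≤ b x) →
      -(ε * ‖h‖) ≤ ∫ x, |(u + h) x| ^ p ∂μ - ∫ x, |u x| ^ p ∂μ - ⟪η, h⟫ := by
  by_contra hc
  obtain ⟨hs, hs0, hbad⟩ := exists_seq_forall_of_frequently (not_eventually.1 hc)
  push Not at hbad
  obtain ⟨ns, -, hae⟩ := (tendstoInMeasure_of_tendsto_Lp hs0).exists_seq_tendsto_ae
  have hum := Lp_measurable u
  have hηm := Lp_measurable η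
  have hhm := fun n => Lp_measurable (hs n)
  set D : ℕ → α → ℝ := fun n x =>
    |u x| ^ p + η x * hs (ns n) x - |u x + hs (ns n) x| ^ p with hD
  set ρ : ℕ → α → ℝ := fun n x => max 0 (D n x) / |hs (ns n) x| with hρ
  have hDm : ∀ n, Measurable (D n) := fun n => by
    have := hhm (ns n)
    fun_prop
  have hρm : ∀ n, Measurable (ρ n) := fun n => by
    have := hhm (ns n)
    have := hDm n
    fun_prop
  have hρ0 : ∀ n x, 0 ≤ ρ n x := fun n x => by positivity
  have hadd : ∀ᵐ x ∂μ, ∀ n, (u + hs (ns n)) x = u x + hs (ns n) x :=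
    ae_all_iff.2 fun n => by filter_upwards [Lp.coeFn_add u (hs (ns n))] with x hx using hx
  have hdir : ∀ᵐ x ∂μ, ∀ n, u x ≠ 0 → 0 ≤ (absRpowDeriv p (u x) - η x) * hs (ns n) x := by
    filter_upwards [H, hadd, ae_all_iff.2 fun n => (hbad (ns n)).1] with x hx hxadd hxS n hne
    have h := hxS n
    rw [hxadd n] at h
    simpa using hx hne _ h.1 h.2
  have hbound : ∀ᵐ x ∂μ, ∀ n, ρ n x ≤ (1 + 1 / p) * |η x| := by
    filter_upwards [hdir] with x hx n
    have hnn : 0 ≤ (1 + 1 / p) * |η x| := by positivity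
    refine div_le_of_le_mul₀ (abs_nonneg _) hnn (max_le (by positivity) ?_)
    exact abs_rpow_defect_le hp0 hp1 (hx n)
  have hlim : ∀ᵐ x ∂μ, Tendsto (fun n => ρ n x) atTop (𝓝 0) := by
    filter_upwards [hdir, hae, Lp.coeFn_zero ℝ 2 μ] with x hx hxt hx0
    rw [hx0, Pi.zero_apply] at hxt
    refine Metric.tendsto_atTop.2 fun δ hδ => ?_
    have := hxt.eventually (eventually_abs_rpow_defect_le hp0 hp1 (u x) (η x) (half_pos hδ))
    obtain ⟨N, hN⟩ := eventually_atTop.1 this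
    refine ⟨N, fun n hn => ?_⟩
    rw [Real.dist_eq, sub_zero, abs_of_nonneg (hρ0 n x)]
    refine lt_of_le_of_lt (div_le_of_le_mul₀ (abs_nonneg _) (half_pos hδ).le
      (max_le (by positivity) (hN n hn (hx n)))) (half_lt_self hδ)
  have hint : Integrable (fun x => ((1 + 1 / p) * |η x|) ^ 2) μ := by
    simp only [mul_pow, sq_abs]
    exact (Lp_integrable_sq η).const_mul _
  have hρle : ∀ n, ∀ᵐ x ∂μ, ‖ρ n x ^ 2‖ ≤ ((1 + 1 / p) * |η x|) ^ 2 := fun n => by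
    filter_upwards [hbound] with x hx
    rw [Real.norm_eq_abs, abs_of_nonneg (sq_nonneg _)]
    exact pow_le_pow_left₀ (hρ0 n x) (hx n) 2
  have htend : Tendsto (fun n => ∫ x, ρ n x ^ 2 ∂μ) atTop (𝓝 (∫ _, (0 : ℝ) ∂μ)) := by
    refine tendsto_integral_of_dominated_convergence _
      (fun n => ((hρm n).pow_const 2).aestronglyMeasurable) hint hρle ?_
    filter_upwards [hlim] with x hx
    simpa using hx.pow 2
  rw [integral_zero] at htend
  obtain ⟨n, hn⟩ := (htend.eventually_lt_const (by positivity : 0 < ε ^ 2)).exists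
  obtain ⟨-, hlt⟩ := hbad (ns n)
  set k := hs (ns n) with hk
  have hM : 0 < ‖k‖ := by
    refine norm_pos_iff.2 fun h0 => ?_
    rw [h0] at hlt
    simp at hlt
  set M := ‖k‖ with hMdef
  have hρint : Integrable (fun x => ρ n x ^ 2) μ :=
    hint.mono' ((hρm n).pow_const 2).aestronglyMeasurable (hρle n)
  have hju := integrable_abs_rpow hp0 hp1 u
  have hjuk : Integrable (fun x => |u x + k x| ^ p) μ :=
    (integrable_abs_rpow hp0 hp1 (u + k)).congr (by
      filter_upwards [hadd] with x hx
      rw [hx n])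
  have hηk := Lp_integrable_mul η k
  have hDint : ∫ x, D n x ∂μ = ∫ x, |u x| ^ p ∂μ + ⟪η, k⟫ - ∫ x, |(u + k) x| ^ p ∂μ := by
    have : ∫ x, |(u + k) x| ^ p ∂μ = ∫ x, |u x + k x| ^ p ∂μ :=
      integral_congr_ae (by
        filter_upwards [hadd] with x hx
        rw [hx n])
    rw [this, Lp_inner_eq_integral, ← integral_add hju hηk]
    exact integral_sub (hju.add hηk) hjuk
  have hpt : ∀ x, D n x ≤ M / (2 * ε) * ρ n x ^ 2 + ε / (2 * M) * k x ^ 2 := fun x => by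
    have h1 : D n x ≤ ρ n x * |k x| := by
      rcases eq_or_ne (k x) 0 with h0 | h0
      · simp [hD, ← hk, h0]
      · rw [hρ]
        simp only [← hk]
        rw [div_mul_cancel₀ _ (abs_ne_zero.2 h0)]
        exact le_max_right _ _
    have h2 : M / (2 * ε) * ρ n x ^ 2 + ε / (2 * M) * k x ^ 2 - ρ n x * |k x| =
        (M * ρ n x - ε * |k x|) ^ 2 / (2 * ε * M) := by
      rw [← sq_abs (k x)]
      field_simp
      ring
    have h3 : 0 ≤ (M * ρ n x - ε * |k x|) ^ 2 / (2 * ε * M) := by positivity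
    linarith
  have hle := integral_mono ((hju.add hηk).sub hjuk)
    ((hρint.const_mul (M / (2 * ε))).add ((Lp_integrable_sq k).const_mul (ε / (2 * M)))) hpt
  have hr : ∫ x, (M / (2 * ε) * ρ n x ^ 2 + ε / (2 * M) * k x ^ 2) ∂μ =
      M / (2 * ε) * ∫ x, ρ n x ^ 2 ∂μ + ε / (2 * M) * M ^ 2 := by
    rw [integral_add (hρint.const_mul _) ((Lp_integrable_sq k).const_mul _),
      integral_const_mul, integral_const_mul, ← Lp_norm_sq_eq_integral]
  have hle' : ∫ x, D n x ∂μ ≤ M / (2 * ε) * ∫ x, ρ n x ^ 2 ∂μ + ε / (2 * M) * M ^ 2 := hr ▸ hle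
  have h1 : M / (2 * ε) * ∫ x, ρ n x ^ 2 ∂μ ≤ M / (2 * ε) * ε ^ 2 :=
    mul_le_mul_of_nonneg_left hn.le (by positivity)
  have h2 : M / (2 * ε) * ε ^ 2 + ε / (2 * M) * M ^ 2 = ε * M := by
    field_simp
    ring
  linarith

lemma ae_nonneg_of_forall_subset_setIntegral_nonneg {f : α → ℝ} {E : Set α}
    (hE : MeasurableSet E) (hf : IntegrableOn f E μ)
    (H : ∀ B, MeasurableSet B → B ⊆ E → 0 ≤ ∫ x in B, f x ∂μ) :
    ∀ᵐ x ∂μ, x ∈ E → 0 ≤ f x :=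
  (ae_restrict_iff' hE).1 <| ae_nonneg_restrict_of_forall_setIntegral_nonneg_inter hf
    fun _ hs _ => H _ (hs.inter hE) Set.inter_subset_right

lemma rpow_sub_one_le {p r y : ℝ} (hp1 : p < 1) (hr : 0 < r) (h : r ≤ y) :
    y ^ (p - 1) ≤ r ^ (p - 1) :=
  Real.rpow_le_rpow_of_nonpos hr h (by linarith)

lemma integrableOn_absRpowDeriv [IsFiniteMeasure μ] {p r : ℝ} (hp0 : 0 < p) (hp1 : p < 1)
    (hr : 0 < r) (u : Lp ℝ 2 μ) {E : Set α} (hE : MeasurableSet E) (hEr : ∀ x ∈ E, r ≤ |u x|) :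
    IntegrableOn (fun x => absRpowDeriv p (u x)) E μ := by
  refine Measure.integrableOn_of_bounded (M := p * r ^ (p - 1)) (measure_ne_top _ _)
    ((measurable_absRpowDeriv p).comp (Lp_measurable u)).aestronglyMeasurable ?_
  refine (ae_restrict_iff' hE).2 (ae_of_all _ fun x hx => ?_)
  have hx := hEr x hx
  rw [Real.norm_eq_abs, abs_absRpowDeriv hp0.le (abs_pos.1 (hr.trans_le hx))]
  exact mul_le_mul_of_nonneg_left (rpow_sub_one_le hp1 hr hx) hp0.le

/-- The Fréchet inequality forces the sign condition in every direction `σ` that is admissible up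
to step length `r`. -/
lemma ae_sign_condition_of_frechet [IsFiniteMeasure μ] {p : ℝ} (hp0 : 0 < p) (hp1 : p < 1)
    {a b u η : Lp ℝ 2 μ} (hu : ∀ᵐ x ∂μ, a x ≤ u x ∧ u x ≤ b x)
    (H : ∀ ε > 0, ∀ᶠ h in 𝓝 (0 : Lp ℝ 2 μ), (∀ᵐ x ∂μ, a x ≤ (u + h) x ∧ (u + h) x ≤ b x) →
      -(ε * ‖h‖) ≤ ∫ x, |(u + h) x| ^ p ∂μ - ∫ x, |u x| ^ p ∂μ - ⟪η, h⟫)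
    (σ : ℝ) {r : ℝ} (hr : 0 < r) :
    ∀ᵐ x ∂μ, r ≤ |u x| → a x ≤ u x + σ * r → u x + σ * r ≤ b x →
      0 ≤ σ * (absRpowDeriv p (u x) - η x) := by
  have hum := Lp_measurable u
  have ham := Lp_measurable a
  have hbm := Lp_measurable b
  set E : Set α := {x | r ≤ |u x|} ∩ ({x | a x ≤ u x + σ * r} ∩ {x | u x + σ * r ≤ b x}) with hEdef
  have hE : MeasurableSet E :=
    (measurableSet_le (by fun_prop) (by fun_prop)).inter
      ((measurableSet_le (by fun_prop) (by fun_prop)).inter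
        (measurableSet_le (by fun_prop) (by fun_prop)))
  have hs := integrableOn_absRpowDeriv hp0 hp1 hr u hE fun x hx => hx.1
  have hη : Integrable η μ := Lp_integrable η
  suffices h : ∀ᵐ x ∂μ, x ∈ E → 0 ≤ σ * (absRpowDeriv p (u x) - η x) by
    filter_upwards [h] with x hx h1 h2 h3 using hx ⟨h1, h2, h3⟩
  refine ae_nonneg_of_forall_subset_setIntegral_nonneg hE ((hs.sub hη.integrableOn).const_mul σ)
    fun B hB hBE => ?_
  have hμB : μ B ≠ ⊤ := measure_ne_top _ _
  set e : Lp ℝ 2 μ := indicatorConstLp 2 hB hμB (1 : ℝ) with he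
  have hηe : (⟪η, e⟫ : ℝ) = ∫ x in B, η x ∂μ := by
    rw [real_inner_comm, he, L2.inner_indicatorConstLp_one]
  have hval : ∀ τ : ℝ, ∀ᵐ x ∂μ,
      (u + (τ * σ) • e) x = u x + τ * σ * B.indicator (fun _ => (1 : ℝ)) x := fun τ => by
    filter_upwards [Lp.coeFn_add u ((τ * σ) • e), Lp.coeFn_smul (τ * σ) e,
      (indicatorConstLp_coeFn : (e : α → ℝ) =ᵐ[μ] _)] with x h1 h2 h3
    rw [h1, Pi.add_apply, h2, Pi.smul_apply, h3, smul_eq_mul]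
  have hadm : ∀ τ : ℝ, 0 ≤ τ → τ ≤ r →
      ∀ᵐ x ∂μ, a x ≤ (u + (τ * σ) • e) x ∧ (u + (τ * σ) • e) x ≤ b x := fun τ hτ hτr => by
    filter_upwards [hval τ, hu] with x hx hux
    rw [hx]
    by_cases hxB : x ∈ B
    · obtain ⟨-, h2, h3⟩ := hBE hxB
      simp only [Set.mem_ofPred_eq] at h2 h3
      simp only [hxB, Set.indicator_of_mem, mul_one]
      rcases le_total 0 σ with h | h
      · constructor <;> nlinarith [mul_nonneg hτ h, mul_le_mul_of_nonneg_right hτr h]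
      · constructor <;> nlinarith [mul_nonneg hτ (neg_nonneg.2 h),
          mul_le_mul_of_nonneg_right hτr (neg_nonneg.2 h)]
    · simpa [hxB] using hux
  have hdiff : ∀ τ : ℝ, ∫ x, |(u + (τ * σ) • e) x| ^ p ∂μ - ∫ x, |u x| ^ p ∂μ =
      ∫ x in B, (|u x + τ * σ| ^ p - |u x| ^ p) ∂μ := fun τ => by
    rw [← integral_sub (integrable_abs_rpow hp0 hp1 _) (integrable_abs_rpow hp0 hp1 _),
      ← integral_indicator hB]
    refine integral_congr_ae ?_
    filter_upwards [hval τ] with x hx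
    rw [hx]
    by_cases hxB : x ∈ B <;> simp [hxB]
  have hlim : Tendsto (fun τ : ℝ => ∫ x in B, τ⁻¹ * (|u x + τ * σ| ^ p - |u x| ^ p) ∂μ) (𝓝[>] 0)
      (𝓝 (∫ x in B, σ * absRpowDeriv p (u x) ∂μ)) := by
    refine tendsto_integral_filter_of_dominated_convergence (fun _ => r ^ (p - 1) * |σ|) ?_ ?_
      (integrable_const _) ?_
    · refine Eventually.of_forall fun τ => Measurable.aestronglyMeasurable ?_
      fun_prop
    · filter_upwards [self_mem_nhdsWithin] with τ hτ
      have hτ : 0 < τ := hτ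
      refine (ae_restrict_iff' hB).2 (ae_of_all _ fun x hx => ?_)
      have hx : r ≤ |u x| := (hBE hx).1
      have h1 := abs_abs_rpow_sub_le hp0 hp1 (abs_pos.1 (hr.trans_le hx)) (τ * σ)
      have h2 := mul_le_mul_of_nonneg_right (rpow_sub_one_le hp1 hr hx) (abs_nonneg (τ * σ))
      rw [Real.norm_eq_abs, abs_mul, abs_inv, abs_of_pos hτ, ← div_eq_inv_mul, div_le_iff₀ hτ]
      rw [abs_mul, abs_of_pos hτ] at h1 h2
      linarith
    · refine (ae_restrict_iff' hB).2 (ae_of_all _ fun x hx => ?_)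
      have hx : r ≤ |u x| := (hBE hx).1
      have h0 : HasDerivAt (fun y : ℝ => |y| ^ p) (absRpowDeriv p (u x)) (u x + 0 * σ) := by
        simpa using hasDerivAt_abs_rpow_const p (abs_pos.1 (hr.trans_le hx))
      have h1 : HasDerivAt (fun τ : ℝ => u x + τ * σ) σ 0 := by
        simpa using ((hasDerivAt_id (0 : ℝ)).mul_const σ).const_add (u x)
      have h2 := HasDerivAt.comp (0 : ℝ) h0 h1
      have h3 := (hasDerivAt_iff_tendsto_slope_zero.1 h2).mono_left
        (nhdsWithin_mono 0 (show Set.Ioi (0 : ℝ) ⊆ {0}ᶜ from fun τ hτ => ne_of_gt hτ))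
      simpa [Function.comp_def, mul_comm] using h3
  have hkey : ∀ ε > 0, -(ε * (|σ| * ‖e‖)) ≤ ∫ x in B, σ * (absRpowDeriv p (u x) - η x) ∂μ := by
    intro ε hε
    have htend : Tendsto (fun τ : ℝ => (τ * σ) • e) (𝓝[>] 0) (𝓝 0) := by
      have : Continuous fun τ : ℝ => (τ * σ) • e := by fun_prop
      simpa using (this.tendsto 0).mono_left nhdsWithin_le_nhds
    have hev : ∀ᶠ τ : ℝ in 𝓝[>] 0, -(ε * (|σ| * ‖e‖)) + σ * ∫ x in B, η x ∂μ ≤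
        ∫ x in B, τ⁻¹ * (|u x + τ * σ| ^ p - |u x| ^ p) ∂μ := by
      filter_upwards [htend.eventually (H ε hε), Ioo_mem_nhdsGT hr] with τ hτ hτr
      have h := hτ (hadm τ hτr.1.le hτr.2.le)
      rw [hdiff, inner_smul_right, hηe, norm_smul, Real.norm_eq_abs, abs_mul,
        abs_of_pos hτr.1] at h
      rw [integral_const_mul, ← div_eq_inv_mul, le_div_iff₀ hτr.1]
      linarith
    have h := ge_of_tendsto hlim hev
    have hsB : IntegrableOn (fun x => σ * absRpowDeriv p (u x)) B μ :=
      (hs.mono_set hBE).const_mul σ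
    simp only [mul_sub]
    rw [integral_sub hsB (hη.integrableOn.const_mul σ), integral_const_mul σ (η : α → ℝ)]
    linarith
  by_contra! hneg
  set I := ∫ x in B, σ * (absRpowDeriv p (u x) - η x) ∂μ
  have hC : 0 ≤ |σ| * ‖e‖ := by positivity
  have h := hkey (-I / (|σ| * ‖e‖ + 1)) (div_pos (by linarith) (by linarith))
  have h2 : -I / (|σ| * ‖e‖ + 1) * (|σ| * ‖e‖) < -I := by
    rw [div_mul_eq_mul_div, div_lt_iff₀ (by linarith)]
    nlinarith
  linarith

/-- The sign conditions are closed under strong convergence of `u` and weak convergence of `η`. -/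
lemma ae_sign_condition_of_tendsto [IsFiniteMeasure μ] {p : ℝ} (hp0 : 0 < p) (hp1 : p < 1)
    {a b u η : Lp ℝ 2 μ} {uk ηk : ℕ → Lp ℝ 2 μ} {σ : ℝ} (hσ : |σ| = 1)
    (hadm : ∀ k, ∀ᵐ x ∂μ, a x ≤ uk k x ∧ uk k x ≤ b x)
    (H : ∀ k, ∀ r > 0, ∀ᵐ x ∂μ, r ≤ |uk k x| → a x ≤ uk k x + σ * r → uk k x + σ * r ≤ b x →
      0 ≤ σ * (absRpowDeriv p (uk k x) - ηk k x))
    (hu : Tendsto uk atTop (𝓝 u))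
    (hη : ∀ v, Tendsto (fun k => (⟪ηk k, v⟫ : ℝ)) atTop (𝓝 ⟪η, v⟫)) {r : ℝ} (hr : 0 < r) :
    ∀ᵐ x ∂μ, r ≤ |u x| → a x ≤ u x + σ * r → u x + σ * r ≤ b x →
      0 ≤ σ * (absRpowDeriv p (u x) - η x) := by
  obtain ⟨ns, hns, hae⟩ := (tendstoInMeasure_of_tendsto_Lp hu).exists_seq_tendsto_ae
  have hum := Lp_measurable u
  have ham := Lp_measurable a
  have hbm := Lp_measurable b
  have hukm := fun k => Lp_measurable (uk k)
  have hηi : Integrable η μ := Lp_integrable η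
  have hr2 := half_pos hr
  set E : ℕ → Set α := fun K =>
    ({x | r ≤ |u x|} ∩ ({x | a x ≤ u x + σ * r} ∩ {x | u x + σ * r ≤ b x})) ∩
      ⋂ k, ⋂ _ : K ≤ k, {x | |uk (ns k) x - u x| ≤ r / 2} with hEdef
  have hE : ∀ K, MeasurableSet (E K) := fun K =>
    ((measurableSet_le (by fun_prop) (by fun_prop)).inter
      ((measurableSet_le (by fun_prop) (by fun_prop)).inter
        (measurableSet_le (by fun_prop) (by fun_prop)))).inter
    (MeasurableSet.iInter fun k => MeasurableSet.iInter fun _ =>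
      measurableSet_le (by have := hukm (ns k); fun_prop) (by fun_prop))
  have hEk : ∀ {K k x}, K ≤ k → x ∈ E K → |uk (ns k) x - u x| ≤ r / 2 := fun hk hx =>
    Set.mem_iInter₂.1 hx.2 _ hk
  have hlow : ∀ {K k x}, K ≤ k → x ∈ E K → r / 2 ≤ |uk (ns k) x| := fun {K k x} hk hx => by
    have h1 : r ≤ |u x| := hx.1.1
    have h2 := hEk hk hx
    have h3 := abs_sub_abs_le_abs_sub (u x) (uk (ns k) x)
    rw [abs_sub_comm] at h3
    linarith
  suffices h : ∀ K, ∀ᵐ x ∂μ, x ∈ E K → 0 ≤ σ * (absRpowDeriv p (u x) - η x) by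
    filter_upwards [ae_all_iff.2 h, hae] with x hx hxt h1 h2 h3
    obtain ⟨K, hK⟩ := Metric.tendsto_atTop.1 hxt (r / 2) hr2
    exact hx K ⟨⟨h1, h2, h3⟩, Set.mem_iInter₂.2 fun k hk => (hK k hk).le⟩
  intro K
  have hs := integrableOn_absRpowDeriv hp0 hp1 hr u (hE K) fun x hx => hx.1.1
  refine ae_nonneg_of_forall_subset_setIntegral_nonneg (hE K)
    ((hs.sub hηi.integrableOn).const_mul σ) fun B hB hBE => ?_
  have hμB : μ B ≠ ⊤ := measure_ne_top _ _
  have hηlim : Tendsto (fun k => ∫ x in B, ηk (ns k) x ∂μ) atTop (𝓝 (∫ x in B, η x ∂μ)) := by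
    have h := (hη (indicatorConstLp 2 hB hμB (1 : ℝ))).comp hns.tendsto_atTop
    simpa only [Function.comp_def, real_inner_comm (indicatorConstLp 2 hB hμB (1 : ℝ)),
      real_inner_comm, L2.inner_indicatorConstLp_one] using h
  have hslim : Tendsto (fun k => ∫ x in B, absRpowDeriv p (uk (ns k) x) ∂μ) atTop
      (𝓝 (∫ x in B, absRpowDeriv p (u x) ∂μ)) := by
    refine tendsto_integral_filter_of_dominated_convergence (fun _ => p * (r / 2) ^ (p - 1)) ?_ ?_
      (integrable_const _) ?_
    · exact Eventually.of_forall fun k =>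
        ((measurable_absRpowDeriv p).comp (hukm (ns k))).aestronglyMeasurable
    · filter_upwards [eventually_ge_atTop K] with k hk
      refine (ae_restrict_iff' hB).2 (ae_of_all _ fun x hx => ?_)
      have hx := hlow hk (hBE hx)
      rw [Real.norm_eq_abs, abs_absRpowDeriv hp0.le (abs_pos.1 (hr2.trans_le hx))]
      exact mul_le_mul_of_nonneg_left (rpow_sub_one_le hp1 hr2 hx) hp0.le
    · refine (ae_restrict_iff' hB).2 ?_
      filter_upwards [hae] with x hx hxB
      have h1 : r ≤ |u x| := (hBE hxB).1.1
      exact (continuousAt_absRpowDeriv p (abs_pos.1 (hr.trans_le h1))).tendsto.comp hx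
  have hlim := (hslim.sub hηlim).const_mul σ
  have hval : ∫ x in B, σ * (absRpowDeriv p (u x) - η x) ∂μ =
      σ * (∫ x in B, absRpowDeriv p (u x) ∂μ - ∫ x in B, η x ∂μ) := by
    rw [integral_const_mul, integral_sub (hs.mono_set hBE) hηi.integrableOn]
  rw [hval]
  refine ge_of_tendsto hlim ?_
  filter_upwards [eventually_ge_atTop K] with k hk
  have hsk := integrableOn_absRpowDeriv hp0 hp1 hr2 (uk (ns k)) hB fun x hx => hlow hk (hBE hx)
  rw [← integral_sub hsk (Lp_integrable (ηk (ns k))).integrableOn, ← integral_const_mul]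
  refine integral_nonneg_of_ae ((ae_restrict_iff' hB).2 ?_)
  filter_upwards [H (ns k) (r / 2) hr2, hadm (ns k)] with x hx hxa hxB
  have h1 := abs_le.1 (hEk hk (hBE hxB))
  obtain ⟨-, h2, h3⟩ := (hBE hxB).1
  simp only [Set.mem_ofPred_eq] at h2 h3
  refine hx (hlow hk (hBE hxB)) ?_ ?_ <;>
    rcases (abs_eq zero_le_one).1 hσ with rfl | rfl <;> linarith


/-- The characterization of both subdifferentials over an arbitrary finite measure. -/
lemma limiting_and_frechet_subdiff_iff [IsFiniteMeasure μ] {p : ℝ} (hp0 : 0 < p) (hp1 : p < 1)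
    {a b ubar : Lp ℝ 2 μ} (hab : ∀ᵐ x ∂μ, a x < b x)
    (hubar : ∀ᵐ x ∂μ, a x ≤ ubar x ∧ ubar x ≤ b x) (η : Lp ℝ 2 μ) :
      (InLimitingSubdiff
        (fun u : Lp ℝ 2 μ =>
          ((∫ x, |u x| ^ p ∂μ : ℝ) : EReal) +
            (if ∀ᵐ x ∂μ, a x ≤ u x ∧ u x ≤ b x then (0 : EReal) else ⊤))
        ubar η ↔
      (∀ᵐ x ∂μ, ubar x ≠ 0 →
        (ubar x = b x → p * (Real.sign (ubar x) * |ubar x| ^ (p - 1)) ≤ η x) ∧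
        (ubar x = a x → η x ≤ p * (Real.sign (ubar x) * |ubar x| ^ (p - 1))) ∧
        (a x < ubar x ∧ ubar x < b x →
          η x = p * (Real.sign (ubar x) * |ubar x| ^ (p - 1))))) ∧
      (InFrechetSubdiff
        (fun u : Lp ℝ 2 μ =>
          ((∫ x, |u x| ^ p ∂μ : ℝ) : EReal) +
            (if ∀ᵐ x ∂μ, a x ≤ u x ∧ u x ≤ b x then (0 : EReal) else ⊤))
        ubar η ↔
      (∀ᵐ x ∂μ, ubar x ≠ 0 →
        (ubar x = b x → p * (Real.sign (ubar x) * |ubar x| ^ (p - 1)) ≤ η x) ∧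
        (ubar x = a x → η x ≤ p * (Real.sign (ubar x) * |ubar x| ^ (p - 1))) ∧
        (a x < ubar x ∧ ubar x < b x →
          η x = p * (Real.sign (ubar x) * |ubar x| ^ (p - 1))))) := by
  let T : Prop := ∀ᵐ x ∂μ, ubar x ≠ 0 →
    (ubar x = b x → p * (Real.sign (ubar x) * |ubar x| ^ (p - 1)) ≤ η x) ∧
    (ubar x = a x → η x ≤ p * (Real.sign (ubar x) * |ubar x| ^ (p - 1))) ∧
    (a x < ubar x ∧ ubar x < b x →
      η x = p * (Real.sign (ubar x) * |ubar x| ^ (p - 1)))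
  set g : Lp ℝ 2 μ → EReal := fun u =>
    ((∫ x, |u x| ^ p ∂μ : ℝ) : EReal) +
      (if ∀ᵐ x ∂μ, a x ≤ u x ∧ u x ≤ b x then (0 : EReal) else ⊤) with hg
  have hiff : ∀ {u η : Lp ℝ 2 μ}, (∀ᵐ x ∂μ, a x ≤ u x ∧ u x ≤ b x) → (InFrechetSubdiff g u η ↔ _) :=
    fun {u η} hu => inFrechetSubdiff_add_indicator_iff (j := fun u : Lp ℝ 2 μ => ∫ x, |u x| ^ p ∂μ)
      (S := fun u : Lp ℝ 2 μ => ∀ᵐ x ∂μ, a x ≤ u x ∧ u x ≤ b x) (u := u) (η := η) hu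
  have hTF : T → InFrechetSubdiff g ubar η := by
    intro h
    refine (hiff hubar).2 fun ε hε => eventually_neg_mul_norm_le hp0 hp1 ?_ hε
    filter_upwards [h, hubar] with x hx hxab hne v hav hvb
    obtain ⟨h1, h2, h3⟩ := hx hne
    change _ → absRpowDeriv p (ubar x) ≤ _ at h1
    change _ → _ ≤ absRpowDeriv p (ubar x) at h2
    change _ → _ = absRpowDeriv p (ubar x) at h3
    rcases hxab.2.eq_or_lt with hb | hb
    · exact mul_nonneg_of_nonpos_of_nonpos (sub_nonpos.2 (h1 hb)) (by linarith)
    rcases hxab.1.eq_or_lt with ha | ha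
    · exact mul_nonneg (sub_nonneg.2 (h2 ha.symm)) (by linarith)
    · rw [h3 ⟨ha, hb⟩, sub_self, zero_mul]
  have hFL : InFrechetSubdiff g ubar η → InLimitingSubdiff g ubar η := fun h =>
    ⟨fun _ => ubar, fun _ => η, tendsto_const_nhds, tendsto_const_nhds,
      fun _ => tendsto_const_nhds, fun _ => h⟩
  have hLT : InLimitingSubdiff g ubar η → T := by
    rintro ⟨uk, ηk, hu, hgu, hη, hF⟩
    have hgtop : g ubar < ⊤ := by
      simp only [hg, hubar, if_true, add_zero]
      exact EReal.coe_lt_top _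
    obtain ⟨N, hN⟩ := eventually_atTop.1 (hgu.eventually_lt_const hgtop)
    have hadm : ∀ k, ∀ᵐ x ∂μ, a x ≤ uk (k + N) x ∧ uk (k + N) x ≤ b x := fun k => by
      by_contra hc
      have := hN (k + N) (Nat.le_add_left N k)
      simp only [hg, hc, if_false, EReal.coe_add_top, lt_self_iff_false] at this
    have hsign : ∀ σ : ℝ, |σ| = 1 → ∀ᵐ x ∂μ, ∀ n : ℕ, 1 / ((n : ℝ) + 1) ≤ |ubar x| →
        a x ≤ ubar x + σ * (1 / ((n : ℝ) + 1)) → ubar x + σ * (1 / ((n : ℝ) + 1)) ≤ b x →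
          0 ≤ σ * (absRpowDeriv p (ubar x) - η x) := fun σ hσ =>
      ae_all_iff.2 fun n => ae_sign_condition_of_tendsto hp0 hp1 hσ hadm
        (fun k r hr => ae_sign_condition_of_frechet hp0 hp1 (hadm k)
          ((hiff (hadm k)).1 (hF (k + N))) σ hr)
        (hu.comp (tendsto_add_atTop_nat N)) (fun v => (hη v).comp (tendsto_add_atTop_nat N))
        Nat.one_div_pos_of_nat
    filter_upwards [hsign 1 (by simp), hsign (-1) (by simp), hubar, hab] with x h1 h2 hx hxab hne
    have hup : ubar x < b x → η x ≤ absRpowDeriv p (ubar x) := fun hb => by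
      obtain ⟨n, hn⟩ := exists_nat_one_div_lt (lt_min (abs_pos.2 hne) (sub_pos.2 hb))
      obtain ⟨hn1, hn2⟩ := lt_min_iff.1 hn
      have hpos : 0 < 1 / ((n : ℝ) + 1) := Nat.one_div_pos_of_nat
      linarith [h1 n hn1.le (by linarith) (by linarith)]
    have hdown : a x < ubar x → absRpowDeriv p (ubar x) ≤ η x := fun ha => by
      obtain ⟨n, hn⟩ := exists_nat_one_div_lt (lt_min (abs_pos.2 hne) (sub_pos.2 ha))
      obtain ⟨hn1, hn2⟩ := lt_min_iff.1 hn
      have hpos : 0 < 1 / ((n : ℝ) + 1) := Nat.one_div_pos_of_nat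
      linarith [h2 n hn1.le (by linarith) (by linarith)]
    exact ⟨fun h => hdown (by rwa [h]), fun h => hup (by rwa [h]),
      fun h => le_antisymm (hup h.2) (hdown h.1)⟩
  exact ⟨⟨hLT, fun h => hFL (hTF h)⟩, ⟨fun h => hLT (hFL h), hTF⟩⟩

end Measure

/-- for `j + I_{U_ad}` (with `j(u) = ∫_Ω |u|^p dx`, `p ∈ (0,1)`, and
`U_ad = {a ≤ u ≤ b}`) at `ū ∈ U_ad`, the limiting subdifferential coincides with the
Fréchet subdifferential, and both equal the set of all `η ∈ L²(Ω)` with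
`η ≥ p|ū|^{p−2}ū` a.e. on `{ū = b} ∩ {ū ≠ 0}`, `η ≤ p|ū|^{p−2}ū` a.e. on
`{ū = a} ∩ {ū ≠ 0}` and `η = p|ū|^{p−2}ū` a.e. on `{a < ū < b} ∩ {ū ≠ 0}`
(where `|ū|^{p−2}ū = sign(ū)·|ū|^{p−1}`). -/
theorem limiting_subdiff_characterization
    {d : ℕ} (hd : 1 ≤ d) (Ω : Set (EuclideanSpace ℝ (Fin d)))
    (hΩ_open : IsOpen Ω) (hΩ_conn : IsConnected Ω) (hΩ_bdd : Bornology.IsBounded Ω)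
    (p : ℝ) (hp0 : 0 < p) (hp1 : p < 1)
    (a b ubar : Lp ℝ 2 (volume.restrict Ω))
    (hab : ∀ᵐ x ∂(volume.restrict Ω), a x < b x)
    (hubar : ∀ᵐ x ∂(volume.restrict Ω), a x ≤ ubar x ∧ ubar x ≤ b x) :
    ∀ η : Lp ℝ 2 (volume.restrict Ω),
      (InLimitingSubdiff
        (fun u : Lp ℝ 2 (volume.restrict Ω) =>
          ((∫ x, |u x| ^ p ∂(volume.restrict Ω) : ℝ) : EReal) +
            (if ∀ᵐ x ∂(volume.restrict Ω), a x ≤ u x ∧ u x ≤ b x then (0 : EReal) else ⊤))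
        ubar η ↔
      (∀ᵐ x ∂(volume.restrict Ω), ubar x ≠ 0 →
        (ubar x = b x → p * (Real.sign (ubar x) * |ubar x| ^ (p - 1)) ≤ η x) ∧
        (ubar x = a x → η x ≤ p * (Real.sign (ubar x) * |ubar x| ^ (p - 1))) ∧
        (a x < ubar x ∧ ubar x < b x →
          η x = p * (Real.sign (ubar x) * |ubar x| ^ (p - 1))))) ∧
      (InFrechetSubdiff
        (fun u : Lp ℝ 2 (volume.restrict Ω) =>
          ((∫ x, |u x| ^ p ∂(volume.restrict Ω) : ℝ) : EReal) +
            (if ∀ᵐ x ∂(volume.restrict Ω), a x ≤ u x ∧ u x ≤ b x then (0 : EReal) else ⊤))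
        ubar η ↔
      (∀ᵐ x ∂(volume.restrict Ω), ubar x ≠ 0 →
        (ubar x = b x → p * (Real.sign (ubar x) * |ubar x| ^ (p - 1)) ≤ η x) ∧
        (ubar x = a x → η x ≤ p * (Real.sign (ubar x) * |ubar x| ^ (p - 1))) ∧
        (a x < ubar x ∧ ubar x < b x →
          η x = p * (Real.sign (ubar x) * |ubar x| ^ (p - 1))))) := by
  have : IsFiniteMeasure (volume.restrict Ω) :=
    isFiniteMeasure_restrict.2 hΩ_bdd.measure_lt_top.ne
  exact fun η => limiting_and_frechet_subdiff_iff hp0 hp1 hab hubar η
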